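/- Let G and H be connected graphs, let M be a nonempty proper module of G, and let G' be the graph obtained from G by replacing G[M] with H. If |M| = |V(H)|, the minimum vertex covers of G[M] and of H have the same size, and the minimum feedback vertex sets of G[M] and of H have the same size, then the size of a minimum feedback vertex set of G' is at most the size of a minimum feedback vertex set of G. -/

import Mathlib

open SimpleGraph Set

/-- `M` is a module of `G`: every vertex outside `M` is adjacent to all of `M`
or to none of `M`. -/
def SimpleGraph.IsModuleSet {V : Type*} (G : SimpleGraph V) (M : Set V) : Prop :=
  ∀ v ∉ M, (∀ m ∈ M, G.Adj v m) ∨ (∀ m ∈ M, ¬ G.Adj v m)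

/-- The graph obtained from `G` by replacing `G[M]` with `H`: its vertices are
`(V ∖ M) ⊕ V(H)`, with the edges of `G` outside `M`, the edges of `H`, and all
edges between `N_G(M) ∖ M` and `V(H)`. -/
def modularReplacement {V W : Type*} (G : SimpleGraph V) (M : Set V)
    (H : SimpleGraph W) : SimpleGraph ({v : V // v ∉ M} ⊕ W) :=
  SimpleGraph.fromRel (fun x y =>
    match x, y with
    | Sum.inl u, Sum.inl v => G.Adj u.1 v.1
    | Sum.inl u, Sum.inr _ => ∃ m ∈ M, G.Adj u.1 m
    | Sum.inr _, Sum.inl _ => False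
    | Sum.inr u, Sum.inr v => H.Adj u v)

section Invariants

variable {V : Type*} (G : SimpleGraph V)

/-- A dominating set. -/
def IsDomSet (D : Set V) : Prop := ∀ v ∉ D, ∃ u ∈ D, G.Adj v u

/-- A minimum dominating set. -/
def IsMinDomSet (D : Set V) : Prop :=
  IsDomSet G D ∧ ∀ D', IsDomSet G D' → D.ncard ≤ D'.ncard

/-- The domination number. -/
noncomputable def domNum : ℕ := sInf {n | ∃ D, IsDomSet G D ∧ D.ncard = n}

/-- A vertex cover. -/
def IsVCover (C : Set V) : Prop := ∀ ⦃u v⦄, G.Adj u v → u ∈ C ∨ v ∈ C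

/-- A minimum vertex cover. -/
def IsMinVCover (C : Set V) : Prop :=
  IsVCover G C ∧ ∀ C', IsVCover G C' → C.ncard ≤ C'.ncard

/-- The vertex cover number. -/
noncomputable def vcNum : ℕ := sInf {n | ∃ C, IsVCover G C ∧ C.ncard = n}

/-- A connected vertex cover. -/
def IsCVCover (C : Set V) : Prop := IsVCover G C ∧ (G.induce C).Connected

/-- A minimum connected vertex cover. -/
def IsMinCVCover (C : Set V) : Prop :=
  IsCVCover G C ∧ ∀ C', IsCVCover G C' → C.ncard ≤ C'.ncard

/-- The connected vertex cover number. -/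
noncomputable def cvcNum : ℕ := sInf {n | ∃ C, IsCVCover G C ∧ C.ncard = n}

/-- A feedback vertex set: its removal leaves an acyclic graph. -/
def IsFVS (S : Set V) : Prop := (G.induce Sᶜ).IsAcyclic

/-- A minimum feedback vertex set. -/
def IsMinFVS (S : Set V) : Prop :=
  IsFVS G S ∧ ∀ S', IsFVS G S' → S.ncard ≤ S'.ncard

/-- The feedback vertex set number. -/
noncomputable def fvsNum : ℕ := sInf {n | ∃ S, IsFVS G S ∧ S.ncard = n}

/-- An odd cycle transversal: its removal leaves a bipartite graph. -/
def IsOCT (S : Set V) : Prop := (G.induce Sᶜ).Colorable 2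

/-- A minimum odd cycle transversal. -/
def IsMinOCT (S : Set V) : Prop :=
  IsOCT G S ∧ ∀ S', IsOCT G S' → S.ncard ≤ S'.ncard

/-- The odd cycle transversal number. -/
noncomputable def octNum : ℕ := sInf {n | ∃ S, IsOCT G S ∧ S.ncard = n}

/-- An independent set: pairwise non-adjacent vertices. -/
def IsIndepSet' (I : Set V) : Prop := I.Pairwise (fun u v => ¬ G.Adj u v)

/-- A partition of `G` into `k` (vertex-disjoint) paths covering all vertices. -/
def IsPathPartition (k : ℕ) (P : Fin k → (u : V) × (v : V) × G.Walk u v) : Prop :=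
  (∀ i, (P i).2.2.IsPath) ∧
  (∀ i j, i ≠ j → ∀ x, x ∈ (P i).2.2.support → x ∉ (P j).2.2.support) ∧
  (∀ x : V, ∃ i, x ∈ (P i).2.2.support)

/-- The minimum number of paths in a partition of `G` into paths. -/
noncomputable def pathPartitionNum : ℕ :=
  sInf {k | ∃ P : Fin k → (u : V) × (v : V) × G.Walk u v, IsPathPartition G k P}

/-- `G` has a Hamiltonian cycle. -/
def HasHamCycle : Prop := ∃ (v : V) (p : G.Walk v v), p.IsCycle ∧ ∀ u : V, u ∈ p.support

/-- The number of vertices of a longest induced path of `G`. -/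
noncomputable def lipNum : ℕ :=
  sSup {n | ∃ S : Set V, Nonempty (G.induce S ≃g pathGraph n)}

/-- `X` is an induced matching with `k` edges: `X` has `2k` vertices and the
subgraph induced by `X` is `1`-regular. -/
def IsInducedMatching (X : Set V) (k : ℕ) : Prop :=
  X.ncard = 2 * k ∧ ∀ v ∈ X, ∃! u, u ∈ X ∧ G.Adj v u

/-- The maximum number of edges of an induced matching of `G`. -/
noncomputable def imNum : ℕ := sSup {k | ∃ X, IsInducedMatching G X k}

/-- An independent triangle packing with `k` triangles: pairwise disjoint
triangles with no edges of `G` between different triangles. -/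
def IsIndepTrianglePacking (k : ℕ) (f : Fin k → Set V) : Prop :=
  (∀ i, ∃ a b c : V, f i = {a, b, c} ∧ G.Adj a b ∧ G.Adj a c ∧ G.Adj b c) ∧
  (∀ i j, i ≠ j → ∀ u ∈ f i, ∀ v ∈ f j, u ≠ v ∧ ¬ G.Adj u v)

/-- The maximum number of triangles in an independent triangle packing of `G`. -/
noncomputable def itpNum : ℕ :=
  sSup {k | ∃ f : Fin k → Set V, IsIndepTrianglePacking G k f}

/-- `C` is the vertex set of an induced cycle of `G`. -/
def IsCycleSet (C : Set V) : Prop :=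
  3 ≤ C.ncard ∧ (G.induce C).Connected ∧ ∀ v ∈ C, {u | u ∈ C ∧ G.Adj v u}.ncard = 2

/-- An independent cycle packing with `k` cycles: pairwise disjoint induced
cycles with no edges of `G` between different cycles. -/
def IsIndepCyclePacking (k : ℕ) (f : Fin k → Set V) : Prop :=
  (∀ i, IsCycleSet G (f i)) ∧
  (∀ i j, i ≠ j → ∀ u ∈ f i, ∀ v ∈ f j, u ≠ v ∧ ¬ G.Adj u v)

/-- The maximum number of cycles in an independent cycle packing of `G`. -/
noncomputable def icpNum : ℕ :=
  sSup {k | ∃ f : Fin k → Set V, IsIndepCyclePacking G k f}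

end Invariants

section ModularReplacementFVS

variable {U V W : Type*}

/-- An induced subgraph is acyclic iff no cycle of the ambient graph stays inside the vertex set. -/
lemma SimpleGraph.isAcyclic_induce_iff {K : SimpleGraph U} {t : Set U} :
    (K.induce t).IsAcyclic ↔
      ∀ ⦃v⦄ (c : K.Walk v v), c.IsCycle → ¬ ∀ x ∈ c.support, x ∈ t := by
  constructor
  · intro h v c hc ht
    refine h (c.induce t ht) (Walk.IsCycle.of_map (f := (Embedding.induce t).toHom) ?_)
    rwa [Walk.map_induce]
  · intro h v c hc
    refine h (c.map (Embedding.induce t).toHom)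
      (hc.map (f := (Embedding.induce t).toHom) Subtype.val_injective) fun x hx ↦ ?_
    rw [Walk.support_map, List.mem_map] at hx
    obtain ⟨y, -, rfl⟩ := hx
    exact y.2

lemma SimpleGraph.IsAcyclic.induce_of_injOn {K : SimpleGraph U} {G : SimpleGraph V}
    {t : Set U} {s : Set V} (hs : (G.induce s).IsAcyclic) (f : U → V) (hf : MapsTo f t s)
    (hinj : InjOn f t) (hadj : ∀ x ∈ t, ∀ y ∈ t, K.Adj x y → G.Adj (f x) (f y)) :
    (K.induce t).IsAcyclic :=
  hs.comap ⟨fun x ↦ ⟨f x, hf x.2⟩, fun {x y} h ↦ hadj x x.2 y y.2 h⟩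
    fun x y h ↦ Subtype.ext (hinj x.2 y.2 (congrArg Subtype.val h))

lemma SimpleGraph.Walk.support_subset_of_closed {K : SimpleGraph U} {t s : Set U}
    (hcl : ∀ x ∈ t, ∀ y ∈ t, x ∈ s → K.Adj x y → y ∈ s) {u v : U} (p : K.Walk u v)
    (hp : ∀ x ∈ p.support, x ∈ t) (hu : u ∈ s) : ∀ x ∈ p.support, x ∈ s := by
  induction p with
  | nil => simpa using hu
  | @cons u w v h p ih =>
    simp only [Walk.support_cons, List.mem_cons, forall_eq_or_imp] at hp ⊢
    exact ⟨hu, ih hp.2 (hcl u hp.1 w (hp.2 _ p.start_mem_support) hu h)⟩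

/-- A graph whose vertex set splits into two acyclic parts without edges between them is acyclic. -/
lemma SimpleGraph.isAcyclic_induce_of_no_cross {K : SimpleGraph U} {t s : Set U}
    (h₁ : (K.induce (t ∩ s)).IsAcyclic) (h₂ : (K.induce (t \ s)).IsAcyclic)
    (hcross : ∀ x ∈ t ∩ s, ∀ y ∈ t \ s, ¬ K.Adj x y) : (K.induce t).IsAcyclic := by
  rw [isAcyclic_induce_iff] at h₁ h₂ ⊢
  intro v c hc ht
  by_cases hv : v ∈ s
  · refine h₁ c hc fun x hx ↦ ⟨ht x hx, c.support_subset_of_closed (t := t) ?_ ht hv x hx⟩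
    intro x hx y hy hxs hxy
    by_contra hys
    exact hcross x ⟨hx, hxs⟩ y ⟨hy, hys⟩ hxy
  · refine h₂ c hc fun x hx ↦
      ⟨ht x hx, c.support_subset_of_closed (t := t) (s := sᶜ) ?_ ht hv x hx⟩
    intro x hx y hy hxs hxy hys
    exact hcross y ⟨hy, hys⟩ x ⟨hx, hxs⟩ hxy.symm

/-- Adding vertices of degree at most one to an acyclic graph leaves it acyclic. -/
lemma SimpleGraph.isAcyclic_induce_of_pendant {K : SimpleGraph U} {t s : Set U}
    (h : (K.induce (t ∩ s)).IsAcyclic)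
    (hpend : ∀ x ∈ t \ s, ∀ a ∈ t, ∀ b ∈ t, K.Adj x a → K.Adj x b → a = b) :
    (K.induce t).IsAcyclic := by
  classical
  rw [isAcyclic_induce_iff] at h ⊢
  intro v c hc ht
  refine h c hc fun x hx ↦ ⟨ht x hx, by_contra fun hxs ↦ ?_⟩
  have hc' := hc.rotate hx
  have ht' : ∀ y ∈ (c.rotate x hx).support, y ∈ t := fun y hy ↦
    ht y ((Walk.mem_support_rotate_iff c _ hx).1 hy)
  exact hc'.snd_ne_penultimate <| hpend x ⟨ht x hx, hxs⟩ _
    (ht' _ (Walk.getVert_mem_support _ _)) _ (ht' _ (Walk.getVert_mem_support _ _))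
    (Walk.adj_snd hc'.not_nil) (Walk.adj_penultimate hc'.not_nil).symm

lemma exists_isVCover_ncard_eq_vcNum (G : SimpleGraph V) :
    ∃ C, IsVCover G C ∧ C.ncard = vcNum G :=
  Nat.sInf_mem (s := {n | ∃ C, IsVCover G C ∧ C.ncard = n})
    ⟨_, Set.univ, fun _ _ _ ↦ Or.inl trivial, rfl⟩

lemma vcNum_le_ncard {G : SimpleGraph V} {C : Set V} (hC : IsVCover G C) : vcNum G ≤ C.ncard :=
  Nat.sInf_le ⟨C, hC, rfl⟩

lemma exists_isFVS_ncard_eq_fvsNum (G : SimpleGraph V) :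
    ∃ S, IsFVS G S ∧ S.ncard = fvsNum G :=
  Nat.sInf_mem (s := {n | ∃ S, IsFVS G S ∧ S.ncard = n})
    ⟨_, Set.univ, fun v ↦ absurd trivial v.2, rfl⟩

lemma fvsNum_le_ncard {G : SimpleGraph V} {S : Set V} (hS : IsFVS G S) : fvsNum G ≤ S.ncard :=
  Nat.sInf_le ⟨S, hS, rfl⟩

lemma ncard_preimage_val_eq (M S : Set V) :
    ((Subtype.val : M → V) ⁻¹' S).ncard = (S ∩ M).ncard := by
  rw [← Set.ncard_image_of_injective _ Subtype.val_injective, Subtype.image_preimage_coe,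
    Set.inter_comm]

section Adjacency

variable {G : SimpleGraph V} {M : Set V} {H : SimpleGraph W}

@[simp] lemma modularReplacement_adj_inl_inl {u v : {v : V // v ∉ M}} :
    (modularReplacement G M H).Adj (Sum.inl u) (Sum.inl v) ↔ G.Adj u v := by
  simp only [modularReplacement, SimpleGraph.fromRel_adj, ne_eq, Sum.inl.injEq]
  refine ⟨fun h ↦ h.2.elim id fun h ↦ h.symm, fun h ↦ ⟨?_, Or.inl h⟩⟩
  rintro rfl
  exact h.ne rfl

@[simp] lemma modularReplacement_adj_inl_inr {u : {v : V // v ∉ M}} {w : W} :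
    (modularReplacement G M H).Adj (Sum.inl u) (Sum.inr w) ↔ ∃ m ∈ M, G.Adj u m := by
  simp [modularReplacement]

@[simp] lemma modularReplacement_adj_inr_inl {u : {v : V // v ∉ M}} {w : W} :
    (modularReplacement G M H).Adj (Sum.inr w) (Sum.inl u) ↔ ∃ m ∈ M, G.Adj u m := by
  simp [modularReplacement]

@[simp] lemma modularReplacement_adj_inr_inr {w x : W} :
    (modularReplacement G M H).Adj (Sum.inr w) (Sum.inr x) ↔ H.Adj w x := by
  simp only [modularReplacement, SimpleGraph.fromRel_adj, ne_eq, Sum.inr.injEq]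
  exact ⟨fun h ↦ h.2.elim id fun h ↦ h.symm, fun h ↦ ⟨h.ne, Or.inl h⟩⟩

end Adjacency

/-- The vertex set of a modular replacement agreeing with `S` outside the module and with `D`
inside the replacing graph. -/
def replacementSet (M S : Set V) (D : Set W) : Set ({v : V // v ∉ M} ⊕ W) :=
  {z | Sum.elim (fun v : {v : V // v ∉ M} ↦ v.1 ∈ S) (fun w ↦ w ∈ D) z}

@[simp] lemma inl_mem_replacementSet {M S : Set V} {D : Set W} {v : {v : V // v ∉ M}} :
    Sum.inl v ∈ replacementSet M S D ↔ v.1 ∈ S := Iff.rfl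

@[simp] lemma inr_mem_replacementSet {M S : Set V} {D : Set W} {w : W} :
    Sum.inr w ∈ replacementSet M S D ↔ w ∈ D := Iff.rfl

lemma ncard_replacementSet_le [Finite V] [Finite W] {M S : Set V} {D : Set W}
    (hD : D.ncard ≤ (S ∩ M).ncard) : (replacementSet M S D).ncard ≤ S.ncard := by
  have h : replacementSet M S D =
      Sum.inl '' ((Subtype.val : {v : V // v ∉ M} → V) ⁻¹' S) ∪ Sum.inr '' D := by
    ext (v | w) <;> simp
  have hl : ((Subtype.val : {v : V // v ∉ M} → V) ⁻¹' S).ncard = (S \ M).ncard :=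
    ncard_preimage_val_eq Mᶜ S
  calc (replacementSet M S D).ncard ≤ (S \ M).ncard + D.ncard := by
        rw [h, ← hl,
          ← Set.ncard_image_of_injective (Subtype.val ⁻¹' S) (Sum.inl_injective (β := W)),
          ← Set.ncard_image_of_injective D (Sum.inr_injective (α := {v : V // v ∉ M}))]
        exact Set.ncard_union_le _ _
    _ ≤ (S \ M).ncard + (S ∩ M).ncard := by gcongr
    _ = S.ncard := by rw [add_comm, Set.ncard_inter_add_ncard_sdiff_eq_ncard]

section FeedbackVertexSets

variable {G : SimpleGraph V} {H : SimpleGraph W} {M S : Set V}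

lemma isAcyclic_induce_replacement_outside (hS : IsFVS G S) (D : Set W) :
    ((modularReplacement G M H).induce
      ((replacementSet M S D)ᶜ ∩ Set.range Sum.inl)).IsAcyclic := by
  rcases isEmpty_or_nonempty V with _ | ⟨⟨v₀⟩⟩
  · rintro ⟨_, -, v, rfl⟩
    exact isEmptyElim v.1
  refine IsAcyclic.induce_of_injOn hS (Sum.elim Subtype.val fun _ ↦ v₀) ?_ ?_ ?_
  · rintro _ ⟨hz, v, rfl⟩
    exact hz
  · rintro _ ⟨-, v, rfl⟩ _ ⟨-, w, rfl⟩ h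
    exact congrArg _ (Subtype.ext h)
  · rintro _ ⟨-, v, rfl⟩ _ ⟨-, w, rfl⟩ h
    exact modularReplacement_adj_inl_inl.1 h

/-- If at most one vertex of the module survives, keep as many vertices of the new graph. -/
lemma exists_isFVS_of_subsingleton [Finite V] [Finite W] (hMod : G.IsModuleSet M)
    (hne : M.Nonempty) (hcard : M.ncard = Nat.card W) (hS : IsFVS G S)
    (hX : (M \ S).Subsingleton) :
    ∃ D : Set W, D.ncard ≤ (S ∩ M).ncard ∧
      IsFVS (modularReplacement G M H) (replacementSet M S D) := by
  have hsum : (S ∩ M).ncard + (M \ S).ncard = M.ncard := by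
    rw [Set.inter_comm, Set.ncard_inter_add_ncard_sdiff_eq_ncard]
  obtain ⟨D, -, hD⟩ : ∃ D ⊆ (Set.univ : Set W), D.ncard = (S ∩ M).ncard :=
    Set.exists_subset_card_eq (by rw [Set.ncard_univ]; omega)
  have hDc : Dᶜ.ncard = (M \ S).ncard := by
    have := Set.ncard_add_ncard_compl D
    omega
  have hDsub : Dᶜ.Subsingleton := by
    rw [← Set.ncard_le_one_iff_subsingleton] at hX ⊢
    omega
  obtain ⟨m, hm, hmS⟩ : ∃ m ∈ M, ∀ w ∉ D, m ∉ S := by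
    rcases (M \ S).eq_empty_or_nonempty with h0 | ⟨m, hm⟩
    · rw [h0, Set.ncard_empty, Set.ncard_eq_zero] at hDc
      obtain ⟨m, hm⟩ := hne
      exact ⟨m, hm, fun w hw ↦ absurd (show w ∈ Dᶜ from hw) (by simp [hDc])⟩
    · exact ⟨m, hm.1, fun _ _ ↦ hm.2⟩
  have hadj : ∀ v : {v : V // v ∉ M}, (∃ m ∈ M, G.Adj v m) → G.Adj v m := by
    rintro v ⟨n, hn, hvn⟩
    exact (hMod v v.2).elim (fun h ↦ h m hm) fun h ↦ absurd hvn (h n hn)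
  refine ⟨D, hD.le, IsAcyclic.induce_of_injOn hS (Sum.elim Subtype.val fun _ ↦ m) ?_ ?_ ?_⟩
  · rintro (v | w) hz
    · exact hz
    · exact hmS w hz
  · rintro (v | w) hz (v' | w') hz' h
    · exact congrArg _ (Subtype.ext h)
    · exact absurd (show v.1 ∈ M from (show v.1 = m from h) ▸ hm) v.2
    · exact absurd (show v'.1 ∈ M from (show m = v'.1 from h) ▸ hm) v'.2
    · exact congrArg _ (hDsub hz hz')
  · rintro (v | w) hz (v' | w') hz' h
    · exact modularReplacement_adj_inl_inl.1 h
    · exact hadj v (modularReplacement_adj_inl_inr.1 h)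
    · exact (hadj v' (modularReplacement_adj_inr_inl.1 h)).symm
    · exact absurd (hDsub hz hz') (modularReplacement_adj_inr_inr.1 h).ne

/-- If every neighbour of the module is deleted, use a minimum feedback vertex set of the new
graph. -/
lemma exists_isFVS_of_neighbors_subset (hfvs : fvsNum (G.induce M) = fvsNum H) (hS : IsFVS G S)
    (hN : ∀ v ∉ M, v ∉ S → ∀ m ∈ M, ¬ G.Adj v m) :
    ∃ D : Set W, D.ncard ≤ (S ∩ M).ncard ∧
      IsFVS (modularReplacement G M H) (replacementSet M S D) := by
  obtain ⟨D, hD, hDcard⟩ := exists_isFVS_ncard_eq_fvsNum H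
  refine ⟨D, ?_, isAcyclic_induce_of_no_cross (isAcyclic_induce_replacement_outside hS D) ?_ ?_⟩
  · rw [hDcard, ← hfvs, ← ncard_preimage_val_eq]
    refine fvsNum_le_ncard (hS.comap ⟨fun x ↦ ⟨x.1.1, x.2⟩, fun h ↦ h⟩ fun x y h ↦ ?_)
    exact Subtype.ext (Subtype.ext (congrArg (fun z : ↥Sᶜ ↦ z.1) h))
  · rcases isEmpty_or_nonempty W with _ | ⟨⟨w₀⟩⟩
    · rintro ⟨v | w, hz⟩
      · exact absurd ⟨v, rfl⟩ hz.2
      · exact (IsEmpty.false w).elim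
    refine IsAcyclic.induce_of_injOn hD (Sum.elim (fun _ ↦ w₀) id) ?_ ?_ ?_
    · rintro (v | w) hz
      · exact absurd ⟨v, rfl⟩ hz.2
      · exact hz.1
    · rintro (v | w) hz (v' | w') hz' h
      · exact absurd ⟨v, rfl⟩ hz.2
      · exact absurd ⟨v, rfl⟩ hz.2
      · exact absurd ⟨v', rfl⟩ hz'.2
      · exact congrArg _ h
    · rintro (v | w) hz (v' | w') hz' h
      · exact absurd ⟨v, rfl⟩ hz.2
      · exact absurd ⟨v, rfl⟩ hz.2
      · exact absurd ⟨v', rfl⟩ hz'.2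
      · exact modularReplacement_adj_inr_inr.1 h
  · rintro _ ⟨hz, v, rfl⟩ (v' | w') hz' h
    · exact hz'.2 ⟨v', rfl⟩
    · obtain ⟨m, hm, hvm⟩ := modularReplacement_adj_inl_inr.1 h
      exact hN v v.2 hz m hm hvm

/-- If only one neighbour of the module survives and the surviving part of the module is
independent, use a minimum vertex cover of the new graph. -/
lemma exists_isFVS_of_neighbors_subsingleton (hvc : vcNum (G.induce M) = vcNum H)
    (hS : IsFVS G S) (hX : IsVCover (G.induce M) (Subtype.val ⁻¹' S))
    (hN : {v | v ∉ M ∧ v ∉ S ∧ ∃ m ∈ M, G.Adj v m}.Subsingleton) :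
    ∃ D : Set W, D.ncard ≤ (S ∩ M).ncard ∧
      IsFVS (modularReplacement G M H) (replacementSet M S D) := by
  obtain ⟨D, hD, hDcard⟩ := exists_isVCover_ncard_eq_vcNum H
  refine ⟨D, ?_, isAcyclic_induce_of_pendant (isAcyclic_induce_replacement_outside hS D) ?_⟩
  · rw [hDcard, ← hvc, ← ncard_preimage_val_eq]
    exact vcNum_le_ncard hX
  · have hout : ∀ w ∉ D, ∀ a ∉ replacementSet M S D,
        (modularReplacement G M H).Adj (Sum.inr w) a →
        ∃ v : {v : V // v ∉ M}, a = Sum.inl v ∧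
          v.1 ∈ {v | v ∉ M ∧ v ∉ S ∧ ∃ m ∈ M, G.Adj v m} := by
      rintro w hw (v | w') ha h
      · exact ⟨v, rfl, v.2, ha, modularReplacement_adj_inr_inl.1 h⟩
      · exact ((hD (modularReplacement_adj_inr_inr.1 h)).elim hw ha).elim
    rintro (v | w) hz a ha b hb hxa hxb
    · exact absurd ⟨v, rfl⟩ hz.2
    · obtain ⟨u, rfl, hu⟩ := hout w hz.1 a ha hxa
      obtain ⟨v, rfl, hv⟩ := hout w hz.1 b hb hxb
      exact congrArg _ (Subtype.ext (hN hu hv))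

/-- Two vertices with two common neighbours cannot all survive. -/
lemma IsFVS.false_of_square (hS : IsFVS G S) {a b c d : V} (hac : a ≠ c) (hbd : b ≠ d)
    (hab : G.Adj a b) (hbc : G.Adj b c) (hcd : G.Adj c d) (hda : G.Adj d a)
    (ha : a ∉ S) (hb : b ∉ S) (hc : c ∉ S) (hd : d ∉ S) : False := by
  refine isAcyclic_induce_iff.1 hS
    (Walk.cons hab (Walk.cons hbc (Walk.cons hcd (Walk.cons hda Walk.nil)))) ?_ ?_
  · simp [Walk.cons_isCycle_iff, hab.ne, hab.ne', hbc.ne, hcd.ne, hda.ne, hda.ne', hac, hac.symm,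
      hbd]
  · simp [ha, hb, hc, hd]

lemma IsFVS.false_of_triangle (hS : IsFVS G S) {a b c : V}
    (hab : G.Adj a b) (hbc : G.Adj b c) (hca : G.Adj c a)
    (ha : a ∉ S) (hb : b ∉ S) (hc : c ∉ S) : False := by
  refine isAcyclic_induce_iff.1 hS
    (Walk.cons hab (Walk.cons hbc (Walk.cons hca Walk.nil))) ?_ ?_
  · simp [Walk.cons_isCycle_iff, hab.ne, hab.ne', hbc.ne, hca.ne, hca.ne']
  · simp [ha, hb, hc]

end FeedbackVertexSets

end ModularReplacementFVS

theorem stmt12 {V W : Type*} [Fintype V] [Fintype W]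
    (G : SimpleGraph V) (H : SimpleGraph W) (M : Set V)
    (hG : G.Connected) (hH : H.Connected)
    (hMod : G.IsModuleSet M) (hne : M.Nonempty) (hproper : M ≠ Set.univ)
    (hcard : M.ncard = Fintype.card W)
    (hvc : vcNum (G.induce M) = vcNum H)
    (hfvs : fvsNum (G.induce M) = fvsNum H) :
    fvsNum (modularReplacement G M H) ≤ fvsNum G := by
  obtain ⟨S, hS, hScard⟩ := exists_isFVS_ncard_eq_fvsNum G
  suffices h : ∃ D : Set W, D.ncard ≤ (S ∩ M).ncard ∧
      IsFVS (modularReplacement G M H) (replacementSet M S D) by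
    obtain ⟨D, hD, hfvsD⟩ := h
    rw [← hScard]
    exact (fvsNum_le_ncard hfvsD).trans (ncard_replacementSet_le hD)
  have hall : ∀ v ∉ M, (∃ m ∈ M, G.Adj v m) → ∀ m ∈ M, G.Adj v m := by
    rintro v hv ⟨n, hn, hvn⟩
    exact (hMod v hv).resolve_right fun h ↦ h n hn hvn
  by_cases hX : (M \ S).Subsingleton
  · exact exists_isFVS_of_subsingleton hMod hne (by rw [hcard, Nat.card_eq_fintype_card]) hS hX
  obtain ⟨x, hx, y, hy, hxy⟩ := Set.not_subsingleton_iff.1 hX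
  by_cases hN : ∀ v ∉ M, v ∉ S → ∀ m ∈ M, ¬ G.Adj v m
  · exact exists_isFVS_of_neighbors_subset hfvs hS hN
  push Not at hN
  obtain ⟨u, huM, huS, n, hn, hun⟩ := hN
  have hu := hall u huM ⟨n, hn, hun⟩
  refine exists_isFVS_of_neighbors_subsingleton hvc hS ?_ ?_
  · intro a b hab
    by_contra! h
    exact hS.false_of_triangle (hu a a.2) hab (hu b b.2).symm huS h.1 h.2
  · rintro v ⟨hvM, hvS, hv⟩ w ⟨hwM, hwS, hw⟩
    by_contra hvw
    exact hS.false_of_square hxy hvw (hall v hvM hv x hx.1).symm (hall v hvM hv y hy.1)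
      (hall w hwM hw y hy.1).symm (hall w hwM hw x hx.1) hx.2 hvS hy.2 hwS
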